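/- Let α, β ≥ 0, let a > 0, and let (q_n)_{n≥1} be a sequence with 0 < q_n < 1 and (1-q_n^n)·a < 1 for all n, such that st-lim q_n = 1 and st-lim q_n^n = b for some b < 1. Then st-lim_n sup_{x∈[0,a], t∈[0,a]} |T_{n,t}^{α,β}(e₁;q_n;x) − (x+t)| = 0, where e₁(s) = s. -/

import Mathlib

open Filter

/-- The `q`-integer `[n]_q = (1 - q^n)/(1 - q)`. -/
noncomputable def qInt (q : ℝ) (n : ℕ) : ℝ := (1 - q ^ n) / (1 - q)

/-- The `q`-factorial `[n]_q! = [1]_q [2]_q ⋯ [n]_q`, with `[0]_q! = 1`. -/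
noncomputable def qFact (q : ℝ) (n : ℕ) : ℝ := ∏ i ∈ Finset.range n, qInt q (i + 1)

/-- The `q`-exponential `e_q^x = ∑ x^n/[n]_q!`. -/
noncomputable def qExp (q x : ℝ) : ℝ := ∑' n : ℕ, x ^ n / qFact q n

/-- The `q`-exponential `E_q^x = ∑ q^{n(n-1)/2} x^n/[n]_q!`. -/
noncomputable def qExpE (q x : ℝ) : ℝ := ∑' n : ℕ, q ^ (n * (n - 1) / 2) * x ^ n / qFact q n

/-- The power series `A(u) = ∑ c_k u^k`. -/
noncomputable def APow (c : ℕ → ℝ) (u : ℝ) : ℝ := ∑' k : ℕ, c k * u ^ k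

/-- The `q`-Appell polynomial `P_k(q;y) = [k]_q! ∑_{j=0}^k c_j y^{k-j}/[k-j]_q!`. -/
noncomputable def qAppell (c : ℕ → ℝ) (q y : ℝ) (k : ℕ) : ℝ :=
  qFact q k * ∑ j ∈ Finset.range (k + 1), c j * y ^ (k - j) / qFact q (k - j)

/-- `D_q A(1) = (A(1) - A(q))/(1-q)`. -/
noncomputable def DqA1 (c : ℕ → ℝ) (q : ℝ) : ℝ := (APow c 1 - APow c q) / (1 - q)

/-- `D_q A(q) = (A(q) - A(q²))/((1-q) q)`. -/
noncomputable def DqAq (c : ℕ → ℝ) (q : ℝ) : ℝ := (APow c q - APow c (q ^ 2)) / ((1 - q) * q)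

/-- `D_q² A(1) = (D_q A(1) - D_q A(q))/(1-q)`. -/
noncomputable def Dq2A1 (c : ℕ → ℝ) (q : ℝ) : ℝ := (DqA1 c q - DqAq c q) / (1 - q)

/-- The Stancu-type `q`-Favard–Szász operator `T_{n,t}^{α,β}(f;q;x)`. -/
noncomputable def Tq (c : ℕ → ℝ) (q : ℝ) (n : ℕ) (t α β : ℝ) (f : ℝ → ℝ) (x : ℝ) : ℝ :=
  qExpE q (-(qInt q n * t)) / APow c 1 *
    ∑' k : ℕ, qAppell c q (qInt q n * t) k / qFact q k *
      f (x + (qInt q k + α) / (qInt q n + β))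

/-- Statistical convergence of a real sequence to `l`. -/
def StatLim (x : ℕ → ℝ) (l : ℝ) : Prop :=
  ∀ ε > 0, Tendsto
    (fun n : ℕ => (((Finset.Icc 1 n).filter fun k => ε ≤ |x k - l|).card : ℝ) / n)
    atTop (nhds 0)

/-- Modulus of continuity of `f` on `[0,∞)`. -/
noncomputable def modCont (f : ℝ → ℝ) (δ : ℝ) : ℝ :=
  sSup {r : ℝ | ∃ u v : ℝ, 0 ≤ u ∧ 0 ≤ v ∧ |u - v| ≤ δ ∧ r = |f u - f v|}

/-- Second-order modulus of smoothness of `f` on `[0,∞)`. -/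
noncomputable def mod2 (f : ℝ → ℝ) (δ : ℝ) : ℝ :=
  sSup {r : ℝ | ∃ h x : ℝ, 0 < h ∧ h ≤ δ ∧ 0 ≤ x ∧
    r = |f (x + 2 * h) - 2 * f (x + h) + f x|}

lemma hs_cauchy {f g : ℕ → ℝ} {F G : ℝ} (hf0 : ∀ k, 0 ≤ f k) (hg0 : ∀ k, 0 ≤ g k)
    (hf : HasSum f F) (hg : HasSum g G) :
    HasSum (fun n => ∑ p ∈ Finset.HasAntidiagonal.antidiagonal n, f p.1 * g p.2) (F * G) := by
  have hf' : Summable fun k => ‖f k‖ := hf.summable.norm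
  have hg' : Summable fun k => ‖g k‖ := hg.summable.norm
  have h1 := (summable_norm_sum_mul_antidiagonal_of_summable_norm hf' hg').of_norm
  have h2 := tsum_mul_tsum_eq_tsum_sum_antidiagonal_of_summable_norm hf' hg'
  rw [hf.tsum_eq, hg.tsum_eq] at h2
  rw [h2]
  exact h1.hasSum

lemma qInt_zero' (q : ℝ) : qInt q 0 = 0 := by simp [qInt]

lemma qInt_pos' {q : ℝ} (h0 : 0 < q) (h1 : q < 1) (n : ℕ) : 0 < qInt q (n + 1) := by
  unfold qInt
  have : q ^ (n + 1) < 1 := pow_lt_one₀ h0.le h1 (by omega)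
  apply div_pos <;> linarith

lemma qInt_nonneg' {q : ℝ} (h0 : 0 < q) (h1 : q < 1) (n : ℕ) : 0 ≤ qInt q n := by
  cases n with
  | zero => simp [qInt]
  | succ n => exact (qInt_pos' h0 h1 n).le

lemma qInt_mul' {q : ℝ} (h1 : q < 1) (n : ℕ) : (1 - q) * qInt q n = 1 - q ^ n := by
  unfold qInt
  have : (1 - q) ≠ 0 := by linarith
  field_simp

lemma qInt_add' {q : ℝ} (h1 : q < 1) (i j : ℕ) :
    qInt q (i + j) = qInt q i + q ^ i * qInt q j := by
  unfold qInt
  have : (1 - q) ≠ 0 := by linarith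
  field_simp
  ring

lemma qInt_le' {q : ℝ} (h0 : 0 < q) (h1 : q < 1) (n : ℕ) : qInt q n ≤ n := by
  have h := one_add_mul_le_pow (a := q - 1) (by linarith) n
  have h2 := qInt_mul' h1 n
  have e : 1 + (q - 1) = q := by ring
  rw [e] at h
  have : (1 - q) * qInt q n ≤ (1 - q) * n := by rw [h2]; linarith
  exact le_of_mul_le_mul_left this (by linarith)

lemma qFact_succ' (q : ℝ) (n : ℕ) : qFact q (n + 1) = qFact q n * qInt q (n + 1) := by
  simp [qFact, Finset.prod_range_succ]

lemma qFact_pos' {q : ℝ} (h0 : 0 < q) (h1 : q < 1) (n : ℕ) : 0 < qFact q n :=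
  Finset.prod_pos fun i _ => qInt_pos' h0 h1 i

lemma w_succ {q : ℝ} (h0 : 0 < q) (h1 : q < 1) (y : ℝ) (n : ℕ) :
    qInt q (n + 1) * (y ^ (n + 1) / qFact q (n + 1)) = y * (y ^ n / qFact q n) := by
  rw [qFact_succ']
  have := (qInt_pos' h0 h1 n).ne'
  have := (qFact_pos' h0 h1 n).ne'
  field_simp
  ring

lemma qInt_tendsto {q : ℝ} (h0 : 0 < q) (h1 : q < 1) :
    Tendsto (fun n => qInt q (n + 1)) atTop (nhds (1 / (1 - q))) := by
  have h := tendsto_pow_atTop_nhds_zero_of_lt_one h0.le h1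
  have h2 := (((tendsto_const_nhds (x := (1 : ℝ))).sub h).div_const (1 - q)).comp (tendsto_add_atTop_nat 1)
  simpa [qInt, Function.comp_def] using h2

lemma w_summable {q : ℝ} (h0 : 0 < q) (h1 : q < 1) {y : ℝ} (hy : 0 ≤ y) (hy1 : (1 - q) * y < 1) :
    Summable fun n => y ^ n / qFact q n := by
  obtain ⟨r, hr1, hr2⟩ := exists_between hy1
  have hq : 0 < 1 - q := by linarith
  have hr : Tendsto (fun n => r * qInt q (n + 1)) atTop (nhds (r * (1 / (1 - q)))) :=
    (qInt_tendsto h0 h1).const_mul r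
  have hlt : y < r * (1 / (1 - q)) := by
    rw [mul_one_div, lt_div_iff₀ hq]; linarith
  refine summable_of_ratio_norm_eventually_le hr2 ?_
  filter_upwards [hr.eventually (lt_mem_nhds hlt)] with n hn
  have hp := qInt_pos' h0 h1 n
  have hF := qFact_pos' h0 h1 n
  have hw : 0 ≤ y ^ n / qFact q n := by positivity
  have hw' : 0 ≤ y ^ (n + 1) / qFact q (n + 1) := by
    have := qFact_pos' h0 h1 (n + 1)
    positivity
  rw [Real.norm_of_nonneg hw, Real.norm_of_nonneg hw']
  have e := w_succ h0 h1 y n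
  refine le_of_mul_le_mul_left ?_ hp
  rw [e]
  nlinarith [mul_le_mul_of_nonneg_right hn.le hw]

lemma tri_succ (n : ℕ) : (n + 1) * (n + 1 - 1) / 2 = n * (n - 1) / 2 + n := by
  have := Nat.choose_two_right (n + 1)
  have h2 := Nat.choose_two_right n
  rw [← this, ← h2, Nat.choose_succ_succ' n 1]
  simp [add_comm]

lemma E_mul_e {q : ℝ} (h0 : 0 < q) (h1 : q < 1) {y : ℝ} (hy : 0 ≤ y) (hy1 : (1 - q) * y < 1) :
    qExpE q (-y) * (∑' n, y ^ n / qFact q n) = 1 := by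
  have hs := w_summable h0 h1 hy hy1
  have hw : ∀ n, 0 ≤ y ^ n / qFact q n := fun n => by
    have := qFact_pos' h0 h1 n
    positivity
  set u : ℕ → ℝ := fun n => q ^ (n * (n - 1) / 2) * (-y) ^ n / qFact q n with hu
  set w : ℕ → ℝ := fun n => y ^ n / qFact q n with hwd
  have husum : Summable fun n => ‖u n‖ := by
    refine Summable.of_nonneg_of_le (fun n => norm_nonneg _) (fun n => ?_) hs
    have hF := qFact_pos' h0 h1 n
    rw [hu]
    simp only [norm_div, norm_mul, norm_pow, norm_neg, Real.norm_of_nonneg hy,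
      Real.norm_of_nonneg h0.le, Real.norm_of_nonneg hF.le]
    rw [mul_div_assoc]
    exact mul_le_of_le_one_left (hw n) (pow_le_one₀ h0.le h1.le)
  have husucc : ∀ n, qInt q (n + 1) * u (n + 1) = - (q ^ n * (y * u n)) := by
    intro n
    simp only [hu]
    rw [qFact_succ', tri_succ, pow_add q, pow_succ (-y)]
    have := (qInt_pos' h0 h1 n).ne'
    have := (qFact_pos' h0 h1 n).ne'
    field_simp
  have hwsucc : ∀ n, qInt q (n + 1) * w (n + 1) = y * w n := fun n => w_succ h0 h1 y n
  unfold qExpE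
  rw [tsum_mul_tsum_eq_tsum_sum_antidiagonal_of_summable_norm husum hs.norm]
  rw [tsum_eq_single 0]
  · simp [hu, hwd, qFact]
  intro m hm
  obtain ⟨m, rfl⟩ := Nat.exists_eq_succ_of_ne_zero hm
  have hp := qInt_pos' h0 h1 m
  have key : qInt q (m + 1) * ∑ p ∈ Finset.HasAntidiagonal.antidiagonal (m + 1), u p.1 * w p.2 = 0 := by
    have e1 : qInt q (m + 1) * ∑ p ∈ Finset.HasAntidiagonal.antidiagonal (m + 1), u p.1 * w p.2
        = ∑ p ∈ Finset.HasAntidiagonal.antidiagonal (m + 1), (qInt q p.1 * u p.1) * w p.2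
        + ∑ p ∈ Finset.HasAntidiagonal.antidiagonal (m + 1), (q ^ p.1 * u p.1) * (qInt q p.2 * w p.2) := by
      rw [Finset.mul_sum, ← Finset.sum_add_distrib]
      refine Finset.sum_congr rfl fun p hp => ?_
      rw [← Finset.HasAntidiagonal.mem_antidiagonal.1 hp, qInt_add' h1]
      ring
    rw [e1, Finset.Nat.sum_antidiagonal_succ, Finset.Nat.sum_antidiagonal_succ']
    simp only [qInt_zero', zero_mul, mul_zero, zero_add, add_zero, husucc, hwsucc]
    rw [← Finset.sum_add_distrib]
    refine Finset.sum_eq_zero fun p _ => ?_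
    ring
  exact (mul_eq_zero.1 key).resolve_left hp.ne'

lemma Tq_e1 (c : ℕ → ℝ) (hc : ∀ k, 0 ≤ c k) {q : ℝ} (h0 : 0 < q) (h1 : q < 1) (A D : ℝ)
    (hA : HasSum c A) (hApos : 0 < A) (hD : HasSum (fun k => c k * qInt q k) D)
    (n : ℕ) (t α β : ℝ) (ht : 0 ≤ t) (ht1 : (1 - q ^ n) * t < 1) (x : ℝ) :
    Tq c q n t α β (fun s => s) x = x + α / (qInt q n + β) +
      (D + (A - (1 - q) * D) * (qInt q n * t)) / A / (qInt q n + β) := by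
  set y := qInt q n * t with hy
  set N := qInt q n + β with hN
  have hy0 : 0 ≤ y := mul_nonneg (qInt_nonneg' h0 h1 n) ht
  have hy1 : (1 - q) * y < 1 := by rw [hy, ← mul_assoc, qInt_mul' h1]; exact ht1
  have hs := w_summable h0 h1 hy0 hy1
  have hE := E_mul_e h0 h1 hy0 hy1
  have hw : ∀ n, 0 ≤ y ^ n / qFact q n := fun n => by
    have := qFact_pos' h0 h1 n
    positivity
  have hAP : APow c 1 = A := by simp [APow, hA.tsum_eq]
  set e := ∑' n, y ^ n / qFact q n with he
  have hes : HasSum (fun n => y ^ n / qFact q n) e := hs.hasSum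
  have hes' : HasSum (fun n => qInt q n * (y ^ n / qFact q n)) (y * e) := by
    rw [← hasSum_nat_add_iff' 1]
    simp only [w_succ h0 h1]
    simpa [qInt_zero'] using hes.mul_left y
  have hq : HasSum (fun k => c k * q ^ k) (A - (1 - q) * D) := by
    have := hA.sub (hD.mul_left (1 - q))
    refine this.congr_fun ?_ |> fun h => h
    intro k
    have := qInt_mul' h1 k
    linear_combination c k * this
  have S0 := hs_cauchy hc hw hA hes
  have S1 := hs_cauchy (fun k => mul_nonneg (hc k) (qInt_nonneg' h0 h1 k)) hw hD hes
  have S2 := hs_cauchy (fun k => mul_nonneg (hc k) (pow_nonneg h0.le k))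
    (fun k => mul_nonneg (qInt_nonneg' h0 h1 k) (hw k)) hq hes'
  have S := (S0.mul_left (x + α / N)).add ((S1.add S2).mul_left (1 / N))
  unfold Tq
  rw [← hy, ← hN, hAP]
  have : (∑' k : ℕ, qAppell c q y k / qFact q k * (x + (qInt q k + α) / N)) =
      (x + α / N) * (A * e) + 1 / N * (D * e + (A - (1 - q) * D) * (y * e)) := by
    rw [← S.tsum_eq]
    refine tsum_congr fun k => ?_
    have hF := (qFact_pos' h0 h1 k).ne'
    have e1 : qAppell c q y k / qFact q k =
        ∑ p ∈ Finset.HasAntidiagonal.antidiagonal k, c p.1 * (y ^ p.2 / qFact q p.2) := by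
      unfold qAppell
      rw [mul_div_cancel_left₀ _ hF, Finset.Nat.sum_antidiagonal_eq_sum_range_succ_mk]
      refine Finset.sum_congr rfl fun j _ => ?_
      rw [mul_div_assoc]
    rw [e1, ← Finset.sum_add_distrib, Finset.sum_mul, Finset.mul_sum, Finset.mul_sum,
      ← Finset.sum_add_distrib]
    refine Finset.sum_congr rfl fun p hp => ?_
    rw [← Finset.HasAntidiagonal.mem_antidiagonal.1 hp, qInt_add' h1]
    ring
  simp only [this]
  have hA' := hApos.ne'
  calc _ = (qExpE q (-y) * e) * ((A / A) * (x + α / N) + (D + (A - (1 - q) * D) * y) / A / N) := by ring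
    _ = _ := by rw [hE, div_self hA']; ring

lemma T_bound (c : ℕ → ℝ) (hc : ∀ k, 0 ≤ c k) {q : ℝ} (h0 : 0 < q) (h1 : q < 1) (A K : ℝ)
    (hA : HasSum c A) (hApos : 0 < A) (hK : HasSum (fun k => c k * (k : ℝ)) K)
    (n : ℕ) (t α β a γ : ℝ) (hα : 0 ≤ α) (hβ : 0 ≤ β) (ht : 0 ≤ t) (hta : t ≤ a)
    (ht1 : (1 - q ^ n) * t < 1) (hγ : 0 < γ) (hn : γ ≤ 1 - q ^ n) (x : ℝ) :
    |Tq c q n t α β (fun s => s) x - (x + t)| ≤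
      (a * (β / γ + K / A) + (K / A + α) / γ) * (1 - q) := by
  have hDs : Summable (fun k => c k * qInt q k) :=
    Summable.of_nonneg_of_le (fun k => mul_nonneg (hc k) (qInt_nonneg' h0 h1 k))
      (fun k => mul_le_mul_of_nonneg_left (qInt_le' h0 h1 k) (hc k)) hK.summable
  obtain ⟨D, hD⟩ := hDs
  have hD0 : 0 ≤ D := hD.nonneg fun k => mul_nonneg (hc k) (qInt_nonneg' h0 h1 k)
  have hDK : D ≤ K := hasSum_le (fun k => mul_le_mul_of_nonneg_left (qInt_le' h0 h1 k) (hc k)) hD hK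
  rw [Tq_e1 c hc h0 h1 A D hA hApos hD n t α β ht ht1 x]
  have hq : 0 < 1 - q := by linarith
  set N := qInt q n with hN
  have hNg : γ ≤ (1 - q) * N := by rw [hN, qInt_mul' h1]; exact hn
  have hNpos : 0 < N := by
    by_contra h
    push Not at h
    nlinarith
  have hNb : 0 < N + β := by linarith
  have hinv : 1 / (N + β) ≤ (1 - q) / γ := by
    rw [div_le_div_iff₀ hNb hγ]
    nlinarith
  have e : x + α / (N + β) + (D + (A - (1 - q) * D) * (N * t)) / A / (N + β) - (x + t)
     = (α + D / A) * (1 / (N + β)) - t * (β * (1 / (N + β)) + (1 - q) * (D / A) * (N / (N + β))) := by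
    field_simp
    ring
  rw [e]
  have hNN : N / (N + β) ≤ 1 := by rw [div_le_one hNb]; linarith
  have hNN0 : 0 ≤ N / (N + β) := by positivity
  have hDA : D / A ≤ K / A := by gcongr
  have hK0 : 0 ≤ K := hD0.trans hDK
  have hKA0 : 0 ≤ K / A := by positivity
  have hDA0 : 0 ≤ D / A := by positivity
  have hi0 : 0 ≤ 1 / (N + β) := by positivity
  have P1 : (α + D / A) * (1 / (N + β)) ≤ (α + K / A) * ((1 - q) / γ) := by gcongr
  have P2 : β * (1 / (N + β)) + (1 - q) * (D / A) * (N / (N + β)) ≤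
      β * ((1 - q) / γ) + (1 - q) * (K / A) * 1 := by gcongr
  have P3 : t * (β * (1 / (N + β)) + (1 - q) * (D / A) * (N / (N + β))) ≤
      a * (β * ((1 - q) / γ) + (1 - q) * (K / A) * 1) := by
    apply mul_le_mul hta P2 _ (by linarith)
    positivity
  have P4 : 0 ≤ (α + D / A) * (1 / (N + β)) := by positivity
  have P5 : 0 ≤ t * (β * (1 / (N + β)) + (1 - q) * (D / A) * (N / (N + β))) := by positivity
  have P6 : (a * (β / γ + K / A) + (K / A + α) / γ) * (1 - q) =
    (α + K / A) * ((1 - q) / γ) + a * (β * ((1 - q) / γ) + (1 - q) * (K / A) * 1) := by ring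
  rw [P6, abs_le]
  constructor <;> linarith

/-- `st-lim_n sup_{x,t ∈ [0,a]} |T_{n,t}^{α,β}(e₁;qₙ;x) − (x+t)| = 0`. -/
theorem stmt_7 (c : ℕ → ℝ) (hc : ∀ k, 0 ≤ c k)
    (hrad : ∃ R : ℝ, 1 < R ∧ Summable fun k => c k * R ^ k) (hA1 : 0 < APow c 1)
    (α β : ℝ) (hα : 0 ≤ α) (hβ : 0 ≤ β) (a : ℝ) (ha : 0 < a)
    (qs : ℕ → ℝ) (hqs : ∀ n, 0 < qs n ∧ qs n < 1)
    (hqa : ∀ n, (1 - qs n ^ n) * a < 1)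
    (hst1 : StatLim qs 1) (b : ℝ) (hb : b < 1)
    (hst2 : StatLim (fun n => qs n ^ n) b) :
    StatLim (fun n => sSup {r : ℝ | ∃ x t : ℝ, x ∈ Set.Icc 0 a ∧ t ∈ Set.Icc 0 a ∧
      r = |Tq c (qs n) n t α β (fun s => s) x - (x + t)|}) 0 := by
  obtain ⟨R, hR, hRs⟩ := hrad
  have hcs : Summable c := by
    refine Summable.of_nonneg_of_le hc (fun k => ?_) hRs
    exact le_mul_of_one_le_right (hc k) (one_le_pow₀ hR.le)
  have hKs : Summable (fun k => c k * (k : ℝ)) := by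
    refine Summable.of_nonneg_of_le (fun k => mul_nonneg (hc k) (Nat.cast_nonneg k))
      (fun k => ?_) (hRs.mul_left (1 / (R - 1)))
    have h := one_add_mul_le_pow (a := R - 1) (by linarith) k
    have e : 1 + (R - 1) = R := by ring
    rw [e] at h
    have hk : (k : ℝ) ≤ 1 / (R - 1) * R ^ k := by
      rw [one_div, inv_mul_eq_div, le_div_iff₀ (by linarith)]
      linarith
    calc c k * (k : ℝ) ≤ c k * (1 / (R - 1) * R ^ k) := mul_le_mul_of_nonneg_left hk (hc k)
      _ = _ := by ring
  have hA : HasSum c (APow c 1) := by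
    have : APow c 1 = ∑' k, c k := by simp [APow]
    rw [this]
    exact hcs.hasSum
  obtain ⟨K, hK⟩ := hKs
  have hK0 : 0 ≤ K := hK.nonneg fun k => mul_nonneg (hc k) (Nat.cast_nonneg k)
  set γ := (1 - b) / 2 with hγd
  have hγ : 0 < γ := by rw [hγd]; linarith
  set C := a * (β / γ + K / APow c 1) + (K / APow c 1 + α) / γ with hC
  have hC0 : 0 ≤ C := by positivity
  intro ε hε
  have L := (hst2 γ hγ).add (hst1 (ε / (C + 1)) (by positivity))
  rw [add_zero] at L
  refine squeeze_zero (fun n => by positivity) (fun n => ?_) L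
  rw [← add_div]
  refine div_le_div_of_nonneg_right ?_ (Nat.cast_nonneg n)
  rw [← Nat.cast_add]
  refine Nat.cast_le.2 (le_trans (Finset.card_le_card ?_) (Finset.card_union_le _ _))
  intro k hk
  rw [Finset.mem_filter] at hk
  rw [Finset.mem_union, Finset.mem_filter, Finset.mem_filter]
  by_contra hcon
  push Not at hcon
  have g1 := hcon.1 hk.1
  have g2 := hcon.2 hk.1
  obtain ⟨hq0, hq1⟩ := hqs k
  have hb1 : γ ≤ 1 - qs k ^ k := by
    have := (abs_lt.1 g1).2
    rw [hγd] at this ⊢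
    linarith
  have hub : sSup {r : ℝ | ∃ x t : ℝ, x ∈ Set.Icc 0 a ∧ t ∈ Set.Icc 0 a ∧
      r = |Tq c (qs k) k t α β (fun s => s) x - (x + t)|} ≤ C * (1 - qs k) := by
    refine Real.sSup_le ?_ (mul_nonneg hC0 (by linarith))
    rintro r ⟨x, t, hx, ht, rfl⟩
    refine T_bound c hc hq0 hq1 (APow c 1) K hA hA1 hK k t α β a γ hα hβ ht.1 ht.2 ?_ hγ hb1 x
    refine lt_of_le_of_lt (mul_le_mul_of_nonneg_left ht.2 (by linarith)) (hqa k)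
  have hlb : 0 ≤ sSup {r : ℝ | ∃ x t : ℝ, x ∈ Set.Icc 0 a ∧ t ∈ Set.Icc 0 a ∧
      r = |Tq c (qs k) k t α β (fun s => s) x - (x + t)|} := by
    refine Real.sSup_nonneg ?_
    rintro r ⟨x, t, hx, ht, rfl⟩
    exact abs_nonneg _
  have h3 := hk.2
  rw [sub_zero, abs_of_nonneg hlb] at h3
  have h4 : 1 - qs k < ε / (C + 1) := by
    have := (abs_lt.1 g2).1
    linarith
  rw [lt_div_iff₀ (by positivity)] at h4
  nlinarith
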